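/- For every real z > 0, Σ_{n=1}^∞ ( ψ(nz) - log(nz) + 1/(2nz) ) + (1/(2z))(γ - log(2πz)) = (1/z) Σ_{n=1}^∞ ( ψ(n/z) - log(n/z) + z/(2n) ) + (1/2)(γ - log(2π/z)), where both series converge. -/

import Mathlib

open Real MeasureTheory Filter

/-- The digamma function `ψ = Γ'/Γ`. -/
noncomputable def digamma (x : ℝ) : ℝ := deriv Real.Gamma x / Real.Gamma x

open Topology

theorem two_div_le_log_add_one_sub_log {y : ℝ} (hy : 0 < y) :
    2 / (2 * y + 1) ≤ log (y + 1) - log y := by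
  have h := le_log_one_add_of_nonneg (inv_nonneg.2 hy.le)
  rw [← log_div (by positivity) hy.ne']
  convert! h using 1
  · field_simp
    ring
  · congr 1
    field_simp

theorem log_add_one_sub_log_le {y : ℝ} (hy : 0 < y) :
    log (y + 1) - log y ≤ (1 / y + 1 / (y + 1)) / 2 := by
  rw [← log_div (by positivity) hy.ne']
  have ht : 0 < (y + 1) / y := by positivity
  have h0 : 0 ≤ log ((y + 1) / y) := log_nonneg (by rw [le_div_iff₀ hy]; linarith)
  have h := self_le_sinh_iff.2 h0
  rw [sinh_log ht] at h
  refine h.trans_eq ?_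
  field_simp
  ring

/-- The error of the trapezoidal rule for `∫ t in y..y + 1, 1 / t`. -/
noncomputable def trapezoidError (y : ℝ) : ℝ :=
  (1 / y + 1 / (y + 1)) / 2 - (log (y + 1) - log y)

theorem trapezoidError_nonneg {y : ℝ} (hy : 0 < y) : 0 ≤ trapezoidError y :=
  sub_nonneg.2 (log_add_one_sub_log_le hy)

theorem trapezoidError_le {y : ℝ} (hy : 0 < y) :
    trapezoidError y ≤ 1 / y ^ 2 - 1 / (y + 1) ^ 2 := by
  have h := two_div_le_log_add_one_sub_log hy
  have h2 : (1 / y + 1 / (y + 1)) / 2 - 2 / (2 * y + 1) ≤ 1 / y ^ 2 - 1 / (y + 1) ^ 2 := by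
    rw [← sub_nonneg]
    have : 1 / y ^ 2 - 1 / (y + 1) ^ 2 - ((1 / y + 1 / (y + 1)) / 2 - 2 / (2 * y + 1))
        = (2 * (2 * y + 1) ^ 2 - y * (y + 1)) / (2 * y ^ 2 * (y + 1) ^ 2 * (2 * y + 1)) := by
      field_simp
      ring
    rw [this]
    apply div_nonneg _ (by positivity)
    nlinarith
  unfold trapezoidError
  linarith

theorem digamma_add_one {x : ℝ} (hx : 0 < x) : digamma (x + 1) = digamma x + 1 / x := by
  have hd : DifferentiableAt ℝ Gamma x := differentiableAt_Gamma fun m => by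
    have : (0 : ℝ) ≤ m := m.cast_nonneg
    linarith
  have hG := (Gamma_pos_of_pos hx).ne'
  have h : deriv Gamma (x + 1) = Gamma x + x * deriv Gamma x := by
    have h1 : (fun y => Gamma (y + 1)) =ᶠ[𝓝 x] fun y => y * Gamma y := by
      filter_upwards [eventually_ne_nhds hx.ne'] with y hy using Gamma_add_one hy
    rw [← deriv_comp_add_const, h1.deriv_eq, deriv_fun_mul differentiableAt_fun_id hd]
    simp
  rw [digamma, digamma, h, Gamma_add_one hx.ne']
  field_simp
  ring

theorem digamma_le_log {x : ℝ} (hx : 0 < x) : digamma x ≤ log x := by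
  have hd : DifferentiableAt ℝ Gamma x := differentiableAt_Gamma fun m => by
    have : (0 : ℝ) ≤ m := m.cast_nonneg
    linarith
  have hG := (Gamma_pos_of_pos hx).ne'
  have h := convexOn_log_Gamma.le_slope_of_hasDerivAt (x := x) (y := x + 1) hx
    (by simp; linarith) (by linarith) (hd.hasDerivAt.log hG)
  rwa [slope_def_field, Function.comp, Function.comp, Gamma_add_one hx.ne', log_mul hx.ne' hG,
    add_sub_cancel_right, add_sub_cancel_left, div_one] at h

theorem log_sub_le_digamma {x : ℝ} (hx : 0 < x) : log x - 1 / x ≤ digamma x := by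
  have hx1 : 0 < x + 1 := by linarith
  have hd : DifferentiableAt ℝ Gamma (x + 1) := differentiableAt_Gamma fun m => by
    have : (0 : ℝ) ≤ m := m.cast_nonneg
    linarith
  have hG := (Gamma_pos_of_pos hx).ne'
  have h := convexOn_log_Gamma.slope_le_of_hasDerivAt (x := x) (y := x + 1) hx
    hx1 (by linarith) (hd.hasDerivAt.log (Gamma_pos_of_pos hx1).ne')
  rw [slope_def_field, Function.comp, Function.comp, Gamma_add_one hx.ne', log_mul hx.ne' hG,
    add_sub_cancel_right, add_sub_cancel_left, div_one, ← Gamma_add_one hx.ne'] at h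
  have := digamma_add_one hx
  unfold digamma at *
  linarith

theorem hasSum_trapezoidError {x : ℝ} (hx : 0 < x) :
    HasSum (fun m : ℕ => trapezoidError (x + m)) (-(digamma x - log x + 1 / (2 * x))) := by
  have hpos (m : ℕ) : 0 < x + m := by positivity
  rw [hasSum_iff_tendsto_nat_of_nonneg fun m => trapezoidError_nonneg (hpos m)]
  set f : ℕ → ℝ := fun m => digamma (x + m) - log (x + m) + 1 / (2 * (x + m)) with hf
  have hsum (n : ℕ) : ∑ m ∈ Finset.range n, trapezoidError (x + m) = f n - f 0 := by
    rw [← Finset.sum_range_sub]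
    refine Finset.sum_congr rfl fun m _ => ?_
    have := hpos m
    simp only [hf, trapezoidError, Nat.cast_add, Nat.cast_one, ← add_assoc,
      digamma_add_one (hpos m)]
    field_simp
    ring
  have hinv : Tendsto (fun m : ℕ => 1 / (x + m)) atTop (𝓝 0) := by
    simp_rw [one_div]
    exact (tendsto_atTop_add_const_left _ _ tendsto_natCast_atTop_atTop).inv_tendsto_atTop
  have hlim : Tendsto f atTop (𝓝 0) := by
    refine squeeze_zero_norm (fun m => ?_) hinv
    have h1 := digamma_le_log (hpos m)
    have h2 := log_sub_le_digamma (hpos m)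
    have h3 : 1 / (2 * (x + m)) = 1 / (x + m) / 2 := by
      field_simp
    have h4 : 0 < 1 / (x + m) := one_div_pos.2 (hpos m)
    rw [norm_eq_abs, abs_le]
    simp only [hf, h3]
    constructor <;> linarith
  simp_rw [hsum]
  simpa [hf] using hlim.sub_const (f 0)

theorem tsum_trapezoidError_le {x : ℝ} (hx : 0 < x) :
    ∑' m : ℕ, trapezoidError (x + m) ≤ 1 / x ^ 2 := by
  refine (hasSum_trapezoidError hx).summable.tsum_le_of_sum_range_le fun n => ?_
  calc ∑ m ∈ Finset.range n, trapezoidError (x + m)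
      ≤ ∑ m ∈ Finset.range n, (1 / (x + m) ^ 2 - 1 / (x + (m + 1 : ℕ)) ^ 2) := by
        refine Finset.sum_le_sum fun m _ => ?_
        push_cast
        rw [← add_assoc]
        exact trapezoidError_le (by positivity)
    _ = 1 / x ^ 2 - 1 / (x + n) ^ 2 := by
        rw [Finset.sum_range_sub' (fun m : ℕ => 1 / (x + m) ^ 2)]
        simp
    _ ≤ 1 / x ^ 2 := by
        have : 0 ≤ 1 / (x + n) ^ 2 := by positivity
        linarith

theorem summable_trapezoidError_prod {z : ℝ} (hz : 0 < z) :
    Summable fun p : ℕ × ℕ => trapezoidError ((p.1 + 1) * z + p.2) := by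
  rw [summable_prod_of_nonneg fun p => trapezoidError_nonneg (by positivity)]
  refine ⟨fun n => (hasSum_trapezoidError (x := (n + 1) * z) (by positivity)).summable, ?_⟩
  refine Summable.of_nonneg_of_le (fun n => tsum_nonneg fun m =>
    trapezoidError_nonneg (by positivity))
    (fun n => tsum_trapezoidError_le (x := (n + 1) * z) (by positivity)) ?_
  have h := (summable_nat_add_iff 1).2 (summable_one_div_nat_pow.2 one_lt_two)
  convert! h.mul_right (1 / z ^ 2) using 2
  push_cast
  field_simp

theorem summable_digamma {z : ℝ} (hz : 0 < z) : Summable fun n : ℕ =>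
    digamma ((n + 1) * z) - log ((n + 1) * z) + 1 / (2 * (n + 1) * z) := by
  have h := (summable_trapezoidError_prod hz).prod.neg
  refine h.congr fun n => ?_
  have := (hasSum_trapezoidError (x := (n + 1) * z) (by positivity)).tsum_eq
  simp only [this, neg_neg, mul_assoc]

theorem tendsto_sum_trapezoidError {z : ℝ} (hz : 0 < z) :
    Tendsto (fun N : ℕ => ∑ n ∈ Finset.range N, ∑ m ∈ Finset.range N,
      trapezoidError ((n + 1) * z + m)) atTop
      (𝓝 (-∑' n : ℕ, (digamma ((n + 1) * z) - log ((n + 1) * z) + 1 / (2 * (n + 1) * z)))) := by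
  have hs := summable_trapezoidError_prod hz
  have hN : Tendsto (fun N : ℕ => Finset.range N ×ˢ Finset.range N) atTop atTop := by
    refine tendsto_atTop_finset_of_monotone (fun a b h => ?_) fun p => ⟨p.1 + p.2 + 1, ?_⟩
    · exact Finset.product_subset_product (Finset.range_mono h) (Finset.range_mono h)
    · simp only [Finset.mem_product, Finset.mem_range]
      omega
  have hS : -∑' n : ℕ, (digamma ((n + 1) * z) - log ((n + 1) * z) + 1 / (2 * (n + 1) * z)) =
      ∑' p : ℕ × ℕ, trapezoidError ((p.1 + 1) * z + p.2) := by
    rw [hs.tsum_prod, ← tsum_neg]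
    refine tsum_congr fun n => ?_
    have := (hasSum_trapezoidError (x := (n + 1) * z) (by positivity)).tsum_eq
    simp only [this, mul_assoc]
  rw [hS]
  refine (hs.hasSum.comp hN).congr fun N => ?_
  simp [Finset.sum_product]

theorem abs_sum_sub_le {f F : ℝ → ℝ}
    (hF : ∀ y, 0 < y → |F (y + 1) - F y - f (y + 1)| ≤ 1 / y - 1 / (y + 1))
    {a : ℝ} (ha : 0 < a) (N : ℕ) :
    |F (a + N) - F a - ∑ n ∈ Finset.range N, f (a + (n + 1))| ≤ 1 / a := by
  have hsum : |F (a + N) - F a - ∑ n ∈ Finset.range N, f (a + (n + 1))| ≤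
      1 / a - 1 / (a + N) := by
    induction N with
    | zero => simp
    | succ N ih =>
      have h := hF (a + N) (by positivity)
      rw [Finset.sum_range_succ]
      push_cast
      rw [← add_assoc]
      rw [abs_le] at *
      constructor <;> linarith
  have : 0 ≤ 1 / (a + N) := by positivity
  linarith

theorem tendsto_sub_sum {f F : ℝ → ℝ}
    (hF : ∀ y, 0 < y → |F (y + 1) - F y - f (y + 1)| ≤ 1 / y - 1 / (y + 1))
    {w : ℝ} (hw : 0 < w) :
    Tendsto (fun N : ℕ => F (N * w + N) - F (N * w) -
      ∑ n ∈ Finset.range N, f (N * w + (n + 1))) atTop (𝓝 0) := by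
  have hinv : Tendsto (fun N : ℕ => 1 / (N * w)) atTop (𝓝 0) := by
    simp_rw [one_div]
    exact (tendsto_natCast_atTop_atTop.atTop_mul_const hw).inv_tendsto_atTop
  refine squeeze_zero_norm' ?_ hinv
  filter_upwards [eventually_gt_atTop 0] with N hN
  exact abs_sum_sub_le hF (by positivity) N

theorem abs_log_add_one_sub_log_sub_le {y : ℝ} (hy : 0 < y) :
    |log (y + 1) - log y - 1 / (y + 1)| ≤ 1 / y - 1 / (y + 1) := by
  have h1 := log_add_one_sub_log_le hy
  have h2 := two_div_le_log_add_one_sub_log hy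
  have h3 : 1 / (y + 1) ≤ 2 / (2 * y + 1) := by
    rw [div_le_div_iff₀ (by positivity) (by positivity)]
    linarith
  have h4 : 1 / (y + 1) ≤ 1 / y := one_div_le_one_div_of_le hy (by linarith)
  rw [abs_le]
  constructor <;> linarith

/-- The non-constant part of Stirling's approximation to `log (Γ (y + 1))`. -/
noncomputable def stirlingMain (y : ℝ) : ℝ := y * log y - y + log y / 2

theorem abs_stirlingMain_add_one_sub_le {y : ℝ} (hy : 0 < y) :
    |stirlingMain (y + 1) - stirlingMain y - log (y + 1)| ≤ 1 / y - 1 / (y + 1) := by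
  have h1 := mul_le_mul_of_nonneg_left (log_add_one_sub_log_le hy) (by positivity : 0 ≤ y + 1 / 2)
  have h2 := mul_le_mul_of_nonneg_left (two_div_le_log_add_one_sub_log hy)
    (by positivity : 0 ≤ y + 1 / 2)
  have h3 : (y + 1 / 2) * (2 / (2 * y + 1)) = 1 := by
    field_simp
  have h4 : (y + 1 / 2) * ((1 / y + 1 / (y + 1)) / 2) = 1 + (1 / y - 1 / (y + 1)) / 4 := by
    field_simp
    ring
  have h5 : 1 / (y + 1) ≤ 1 / y := one_div_le_one_div_of_le hy (by linarith)
  have h6 : stirlingMain (y + 1) - stirlingMain y - log (y + 1) =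
      (y + 1 / 2) * (log (y + 1) - log y) - 1 := by
    unfold stirlingMain
    ring
  rw [h6, abs_le]
  constructor <;> linarith

theorem tendsto_stirlingMain_sub_sum_log :
    Tendsto (fun N : ℕ => stirlingMain N - ∑ n ∈ Finset.range N, log (n + 1)) atTop
      (𝓝 (-(log (2 * π) / 2))) := by
  have h := (Stirling.tendsto_stirlingSeq_sqrt_pi.log (by positivity)).add_const (log 2 / 2)
  have hπ : log √π + log 2 / 2 = log (2 * π) / 2 := by
    rw [log_sqrt pi_nonneg, log_mul two_ne_zero pi_ne_zero]
    ring
  rw [hπ] at h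
  refine h.neg.congr' ?_
  filter_upwards [eventually_gt_atTop 0] with N hN
  have hN' : (N : ℝ) ≠ 0 := by positivity
  have hfac : log (N.factorial : ℝ) = ∑ n ∈ Finset.range N, log (n + 1) := by
    rw [← Finset.prod_range_add_one_eq_factorial, Nat.cast_prod, log_prod]
    · simp
    · intro n _
      positivity
  rw [Stirling.log_stirlingSeq_formula, hfac, log_mul two_ne_zero hN',
    log_div hN' (exp_ne_zero 1), log_exp, stirlingMain]
  ring

theorem sum_trapezoidError {x : ℝ} (hx : 0 < x) (M : ℕ) :
    ∑ m ∈ Finset.range M, trapezoidError (x + m) =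
      1 / (2 * x) - 1 / (2 * (x + M)) + ∑ m ∈ Finset.range M, 1 / (x + (m + 1)) -
        (log (x + M) - log x) := by
  induction M with
  | zero => simp
  | succ M ih =>
    have : 0 < x + M := by positivity
    rw [Finset.sum_range_succ, Finset.sum_range_succ, ih, trapezoidError]
    push_cast
    rw [← add_assoc]
    field_simp
    ring_nf

/-- The part of the square partial sums of the double series that is not symmetric under
`z ↦ 1 / z`, as a function of `w = 1 / z`. -/
noncomputable def asymmetricPart (w : ℝ) (N : ℕ) : ℝ :=
  w / 2 * (∑ n ∈ Finset.range N, 1 / ((n : ℝ) + 1) -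
      ∑ n ∈ Finset.range N, 1 / (N * w + (n + 1))) -
    (∑ n ∈ Finset.range N, log (N * w + (n + 1)) - ∑ n ∈ Finset.range N, log ((n : ℝ) + 1))

theorem sum_sum_trapezoidError {z : ℝ} (hz : 0 < z) (N : ℕ) :
    ∑ n ∈ Finset.range N, ∑ m ∈ Finset.range N, trapezoidError ((n + 1) * z + m) =
      ∑ n ∈ Finset.range N, ∑ m ∈ Finset.range N, 1 / (((n : ℝ) + 1) * z + (m + 1)) +
        asymmetricPart (1 / z) N := by
  simp only [asymmetricPart, ← Finset.sum_sub_distrib, Finset.mul_sum, ← Finset.sum_add_distrib]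
  refine Finset.sum_congr rfl fun n _ => ?_
  rw [sum_trapezoidError (by positivity)]
  have hn : (0 : ℝ) < n + 1 := by positivity
  have hlog : log ((n + 1) * z + N) = log z + log (N * (1 / z) + (n + 1)) := by
    rw [← log_mul hz.ne' (by positivity)]
    congr 1
    field_simp
    ring
  have hinv : 1 / (2 * ((n + 1) * z + N)) = 1 / z / 2 * (1 / (N * (1 / z) + (n + 1))) := by
    field_simp
    ring
  rw [hlog, hinv, log_mul hn.ne' hz.ne']
  field_simp
  ring

theorem sum_sum_one_div_symm {z : ℝ} (hz : 0 < z) (N : ℕ) :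
    1 / z * ∑ n ∈ Finset.range N, ∑ m ∈ Finset.range N,
        1 / (((n : ℝ) + 1) * (1 / z) + (m + 1)) =
      ∑ n ∈ Finset.range N, ∑ m ∈ Finset.range N, 1 / (((n : ℝ) + 1) * z + (m + 1)) := by
  rw [Finset.sum_comm]
  simp only [Finset.mul_sum]
  refine Finset.sum_congr rfl fun n _ => Finset.sum_congr rfl fun m _ => ?_
  field_simp
  ring

theorem tendsto_asymmetricPart {w : ℝ} (hw : 0 < w) :
    Tendsto (fun N : ℕ => asymmetricPart w N +
      (N * ((1 + w) * log (1 + w) - w * log w) +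
        (log (1 + w) - log w - log N - log (2 * π)) / 2 +
        w / 2 * (log (1 + w) - log w - log N - eulerMascheroniConstant))) atTop (𝓝 0) := by
  have h1 := tendsto_sub_sum (F := stirlingMain) (f := log)
    (fun y hy => abs_stirlingMain_add_one_sub_le hy) hw
  have h2 := tendsto_sub_sum (F := log) (f := fun y => 1 / y)
    (fun y hy => abs_log_add_one_sub_log_sub_le hy) hw
  have h3 := tendsto_stirlingMain_sub_sum_log
  have h4 := tendsto_harmonic_sub_log
  have h := ((h1.sub h3).add ((h2.add h4).const_mul (w / 2))).sub_const
    (log (2 * π) / 2 + w / 2 * eulerMascheroniConstant)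
  refine (h.congr' ?_).trans_eq ?_
  · filter_upwards [eventually_gt_atTop 0] with N hN
    have hN' : (0 : ℝ) < N := by positivity
    have hlog : log (N * w + N) = log N + log (1 + w) := by
      rw [← log_mul hN'.ne' (by positivity)]
      congr 1
      ring
    have hH : ((harmonic N : ℚ) : ℝ) = ∑ n ∈ Finset.range N, 1 / ((n : ℝ) + 1) := by
      simp [harmonic]
    simp only [asymmetricPart, stirlingMain, hlog, log_mul hN'.ne' hw.ne', hH]
    ring
  · congr 1
    ring

theorem tsum_digamma_transformation {z : ℝ} (hz : 0 < z) :
    (∑' n : ℕ, (digamma ((n + 1) * z) - log ((n + 1) * z) + 1 / (2 * (n + 1) * z)))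
        + (1 / (2 * z)) * (eulerMascheroniConstant - log (2 * π * z))
      = (1 / z) * (∑' n : ℕ, (digamma ((n + 1) * (1 / z)) - log ((n + 1) * (1 / z)) +
          1 / (2 * (n + 1) * (1 / z))))
        + (1 / 2) * (eulerMascheroniConstant - log (2 * π / z)) := by
  have hw : 0 < 1 / z := by positivity
  have hS := (tendsto_sum_trapezoidError hz).sub
    ((tendsto_sum_trapezoidError hw).const_mul (1 / z))
  have hA := ((tendsto_asymmetricPart hw).sub
    ((tendsto_asymmetricPart hz).const_mul (1 / z))).add_const
    (1 / (2 * z) * (eulerMascheroniConstant - log (2 * π * z)) -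
      1 / 2 * (eulerMascheroniConstant - log (2 * π / z)))
  have h := tendsto_nhds_unique (hS.congr' ?_) hA
  · linarith
  · filter_upwards with N
    have hlog : log (1 + 1 / z) = log (1 + z) - log z := by
      rw [← log_div (by positivity) hz.ne']
      congr 1
      field_simp
      ring
    rw [sum_sum_trapezoidError hz, sum_sum_trapezoidError hw, one_div_one_div, mul_add,
      sum_sum_one_div_symm hz, hlog, log_mul (by positivity) hz.ne',
      log_div (x := 2 * π) (by positivity) hz.ne', one_div z, log_inv]
    field_simp
    ring_nf

theorem guinand_transformation_real (z : ℝ) (hz : 0 < z) :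
    Summable (fun n : ℕ =>
      digamma ((n + 1) * z) - Real.log ((n + 1) * z) + 1 / (2 * (n + 1) * z)) ∧
    Summable (fun n : ℕ =>
      digamma ((n + 1) / z) - Real.log ((n + 1) / z) + z / (2 * (n + 1))) ∧
    (∑' n : ℕ, (digamma ((n + 1) * z) - Real.log ((n + 1) * z) + 1 / (2 * (n + 1) * z)))
        + (1 / (2 * z)) * (Real.eulerMascheroniConstant - Real.log (2 * π * z))
      = (1 / z) * (∑' n : ℕ,
          (digamma ((n + 1) / z) - Real.log ((n + 1) / z) + z / (2 * (n + 1))))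
        + (1 / 2) * (Real.eulerMascheroniConstant - Real.log (2 * π / z)) := by
  have hterm (n : ℕ) : digamma ((n + 1) * (1 / z)) - log ((n + 1) * (1 / z)) +
      1 / (2 * (n + 1) * (1 / z)) =
      digamma ((n + 1) / z) - log ((n + 1) / z) + z / (2 * (n + 1)) := by
    rw [mul_one_div, mul_one_div, one_div_div]
  have hs := summable_digamma (one_div_pos.2 hz)
  have h := tsum_digamma_transformation hz
  simp only [hterm] at hs h
  exact ⟨summable_digamma hz, hs, h⟩
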